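/- Let d ∈ ℕ, 1 < p ≤ 2, 0 < θ ≤ 2, θ < η ≤ ∞ and r = 1/p + 1/θ − 1. Then σ_m(S^r_{p,θ}B)_{A_η} ≍ m^{−(1/θ − 1/η)}. -/

import Mathlib

open MeasureTheory Real ENNReal

noncomputable section

namespace Paper

/-- The fundamental domain `[0,1)^d` of the `d`-dimensional torus `𝕋^d`. -/
def cube (d : ℕ) : Set (Fin d → ℝ) := Set.univ.pi fun _ => Set.Ico (0:ℝ) 1

/-- The trigonometric character `x ↦ e^{2π i k·x}`. -/
def expk (d : ℕ) (k : Fin d → ℤ) (x : Fin d → ℝ) : ℂ :=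
  Complex.exp (((2 * Real.pi * ∑ i, (k i : ℝ) * x i : ℝ) : ℂ) * Complex.I)

/-- Fourier coefficient `f̂(k) = ∫_{[0,1)^d} f(x) e^{-2π i k·x} dx`. -/
def fCoeff (d : ℕ) (f : (Fin d → ℝ) → ℂ) (k : Fin d → ℤ) : ℂ :=
  ∫ x in cube d, f x * expk d (-k) x

/-- The `L_q` (quasi-)norm on the torus, `q ∈ (0,∞]`, valued in `ℝ≥0∞`
(for `q = ∞` this is the essential supremum). -/
def LqNorm (d : ℕ) (q : ℝ≥0∞) (f : (Fin d → ℝ) → ℂ) : ℝ≥0∞ :=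
  eLpNorm f q (volume.restrict (cube d))

/-- The weight `∏_{i=1}^d (1+|k_i|)`. -/
def wt (d : ℕ) (k : Fin d → ℤ) : ℝ := ∏ i, (1 + |(k i : ℝ)|)

/-- The weighted Wiener (quasi-)norm `‖f‖_{S^r_θ A}`
(with the sup modification for `θ = ∞`); `A_θ` corresponds to `r = 0`,
the Wiener algebra `A` to `r = 0`, `θ = 1`. -/
def wienerNorm (d : ℕ) (r : ℝ) (θ : ℝ≥0∞) (f : (Fin d → ℝ) → ℂ) : ℝ≥0∞ :=
  if θ = ∞ then ⨆ k : Fin d → ℤ, ENNReal.ofReal (wt d k ^ r) * (‖fCoeff d f k‖₊ : ℝ≥0∞)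
  else (∑' k : Fin d → ℤ,
      (ENNReal.ofReal (wt d k ^ r) * (‖fCoeff d f k‖₊ : ℝ≥0∞)) ^ θ.toReal) ^ (1 / θ.toReal)

/-- Trigonometric polynomials with at most `m` terms. -/
def trigPoly (d m : ℕ) : Set ((Fin d → ℝ) → ℂ) :=
  {s | ∃ (Λ : Finset (Fin d → ℤ)) (a : (Fin d → ℤ) → ℂ),
    Λ.card ≤ m ∧ s = fun x => ∑ k ∈ Λ, a k * expk d k x}

/-- Best `m`-term trigonometric approximation error of `f`, error measured by `X`. -/
def sigmaF (d m : ℕ) (X : ((Fin d → ℝ) → ℂ) → ℝ≥0∞) (f : (Fin d → ℝ) → ℂ) : ℝ≥0∞ :=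
  ⨅ s ∈ trigPoly d m, X (f - s)

/-- The unit ball of the space (inside `L₁(𝕋^d)`) with (quasi-)norm `N`. -/
def unitBall (d : ℕ) (N : ((Fin d → ℝ) → ℂ) → ℝ≥0∞) : Set ((Fin d → ℝ) → ℂ) :=
  {f | IntegrableOn f (cube d) ∧ N f ≤ 1}

/-- Best `m`-term trigonometric width of the unit ball of `N`, error measured by `X`. -/
def sigmaClass (d m : ℕ) (N X : ((Fin d → ℝ) → ℂ) → ℝ≥0∞) : ℝ≥0∞ :=
  ⨆ f ∈ unitBall d N, sigmaF d m X f

/-- `log*(m) = max (log₂ m) 1`. -/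
def logStar (m : ℕ) : ℝ := max (Real.logb 2 m) 1

/-- Two-sided asymptotic equivalence `a_m ≍ b_m`. -/
def IsAsympEquiv (a : ℕ → ℝ≥0∞) (b : ℕ → ℝ) : Prop :=
  ∃ c C : ℝ, 0 < c ∧ 0 < C ∧ ∃ m₀ : ℕ, ∀ m : ℕ, m₀ ≤ m →
    ENNReal.ofReal (c * b m) ≤ a m ∧ a m ≤ ENNReal.ofReal (C * b m)

/-- One-sided asymptotic bound `a_m ≲ b_m`. -/
def IsAsympLe (a : ℕ → ℝ≥0∞) (b : ℕ → ℝ) : Prop :=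
  ∃ C : ℝ, 0 < C ∧ ∃ m₀ : ℕ, ∀ m : ℕ, m₀ ≤ m → a m ≤ ENNReal.ofReal (C * b m)

/-- Dyadic block `I_0 = {0}`, `I_n = {k : 2^{n-1} ≤ |k| < 2^n}` for `n ≥ 1`. -/
def blockF (n : ℕ) : Finset ℤ :=
  (Finset.Icc (-(2^n : ℤ)) (2^n)).filter fun k =>
    (n = 0 ∧ k = 0) ∨ (n ≠ 0 ∧ 2^(n-1) ≤ |k| ∧ |k| < 2^n)

/-- The dyadic block projection `∑_{k ∈ I_j} f̂(k) e^{2π i k·x}`. -/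
def blockProj (d : ℕ) (f : (Fin d → ℝ) → ℂ) (j : Fin d → ℕ) : (Fin d → ℝ) → ℂ :=
  fun x => ∑ k ∈ Fintype.piFinset (fun i => blockF (j i)), fCoeff d f k * expk d k x

/-- The mixed-smoothness Besov (quasi-)norm `‖f‖_{S^s_{p,θ}B}`
(with the sup modification for `θ = ∞`). -/
def besovNorm (d : ℕ) (s : ℝ) (p θ : ℝ≥0∞) (f : (Fin d → ℝ) → ℂ) : ℝ≥0∞ :=
  if θ = ∞ then
    ⨆ j : Fin d → ℕ,
      ENNReal.ofReal ((2:ℝ) ^ (((∑ i, j i : ℕ) : ℝ) * s)) * LqNorm d p (blockProj d f j)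
  else
    (∑' j : Fin d → ℕ,
      (ENNReal.ofReal ((2:ℝ) ^ (((∑ i, j i : ℕ) : ℝ) * s)) * LqNorm d p (blockProj d f j))
        ^ θ.toReal) ^ (1 / θ.toReal)

/-- The mixed-smoothness Sobolev norm `‖f‖_{S^s_p W}` (Littlewood–Paley form),
with `S^0_p W := L_p`. -/
def sobolevNorm (d : ℕ) (s : ℝ) (p : ℝ≥0∞) (f : (Fin d → ℝ) → ℂ) : ℝ≥0∞ :=
  if s = 0 then LqNorm d p f
  else
    (∫⁻ x in cube d,
      ((∑' j : Fin d → ℕ,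
        (ENNReal.ofReal ((2:ℝ) ^ (((∑ i, j i : ℕ) : ℝ) * s)) *
          (‖blockProj d f j x‖₊ : ℝ≥0∞)) ^ (2:ℕ)) ^ ((1:ℝ)/2)) ^ p.toReal) ^ (1 / p.toReal)

/-- Trigonometric polynomials with frequencies in `[-M,M]^d`. -/
def boxPoly (d M : ℕ) : Set ((Fin d → ℝ) → ℂ) :=
  {s | ∃ (Λ : Finset (Fin d → ℤ)) (a : (Fin d → ℤ) → ℂ),
    (∀ k ∈ Λ, ∀ i, |k i| ≤ (M : ℤ)) ∧ s = fun x => ∑ k ∈ Λ, a k * expk d k x}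

/-- Error of best approximation by trigonometric polynomials with
frequencies in `[-M,M]^d`, measured in `L_∞`. -/
def EBox (d M : ℕ) (f : (Fin d → ℝ) → ℂ) : ℝ≥0∞ :=
  ⨅ g ∈ boxPoly d M, LqNorm d ∞ (f - g)

/-- The `m`-th (non-linear) sampling width of the class of continuous functions
in the unit ball of `N`, error measured in `L_q`. -/
def samplingWidth (d m : ℕ) (N : ((Fin d → ℝ) → ℂ) → ℝ≥0∞) (q : ℝ≥0∞) : ℝ≥0∞ :=
  ⨅ (t : Fin m → (Fin d → ℝ)) (_ : ∀ i, t i ∈ cube d)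
    (R : (Fin m → ℂ) → ((Fin d → ℝ) → ℂ)),
    ⨆ f ∈ {f : (Fin d → ℝ) → ℂ | Continuous f ∧ N f ≤ 1},
      LqNorm d q (f - R fun i => f (t i))


lemma continuous_expk (d : ℕ) (k : Fin d → ℤ) : Continuous (expk d k) := by
  unfold expk; fun_prop

lemma norm_expk (d : ℕ) (k : Fin d → ℤ) (x : Fin d → ℝ) : ‖expk d k x‖ = 1 :=
  Complex.norm_exp_ofReal_mul_I _

lemma expk_add (d : ℕ) (k l : Fin d → ℤ) (x : Fin d → ℝ) :
    expk d (k + l) x = expk d k x * expk d l x := by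
  simp only [expk, ← Complex.exp_add, ← add_mul, ← Complex.ofReal_add, ← mul_add,
    ← Finset.sum_add_distrib, Pi.add_apply, Int.cast_add]

lemma conj_expk (d : ℕ) (k : Fin d → ℤ) (x : Fin d → ℝ) :
    starRingEnd ℂ (expk d k x) = expk d (-k) x := by
  rw [expk, ← Complex.exp_conj, map_mul, Complex.conj_ofReal, Complex.conj_I, expk]
  congr 1
  simp

lemma volume_restrict_cube (d : ℕ) :
    (volume : Measure (Fin d → ℝ)).restrict (cube d) =
      Measure.pi fun _ => (volume : Measure ℝ).restrict (Set.Ico 0 1) := by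
  rw [cube, volume_pi, Measure.restrict_pi_pi]

lemma isProbabilityMeasure_cube (d : ℕ) :
    IsProbabilityMeasure ((volume : Measure (Fin d → ℝ)).restrict (cube d)) := by
  have : IsProbabilityMeasure ((volume : Measure ℝ).restrict (Set.Ico 0 1)) := ⟨by simp⟩
  rw [volume_restrict_cube]
  infer_instance

lemma integral_exp_two_pi_int_mul (n : ℤ) :
    ∫ x in Set.Ico (0 : ℝ) 1, Complex.exp (2 * π * n * x * Complex.I) =
      if n = 0 then 1 else 0 := by
  rw [integral_Ico_eq_integral_Ioo, ← integral_Ioc_eq_integral_Ioo,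
    ← intervalIntegral.integral_of_le zero_le_one]
  split_ifs with h
  · simp [h]
  · have hc : (2 * π * n * Complex.I : ℂ) ≠ 0 := by
      simp [h, Real.pi_ne_zero]
    have := integral_exp_mul_complex (a := 0) (b := 1) hc
    have h1 : Complex.exp (2 * π * n * Complex.I) = 1 :=
      Complex.exp_eq_one_iff.2 ⟨n, by ring⟩
    simp only [Complex.ofReal_one, mul_one, h1, Complex.ofReal_zero, mul_zero, Complex.exp_zero,
      sub_self, zero_div] at this
    rw [← this]
    congr 1; ext x; congr 1; ring

lemma integral_expk (d : ℕ) (k : Fin d → ℤ) :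
    ∫ x in cube d, expk d k x = if k = 0 then 1 else 0 := by
  have h : ∀ x : Fin d → ℝ,
      expk d k x = ∏ i, Complex.exp (2 * π * k i * x i * Complex.I) := by
    intro x
    rw [← Complex.exp_sum, expk, ← Finset.sum_mul]
    push_cast
    simp only [Finset.mul_sum, mul_assoc]
  simp only [h]
  rw [volume_restrict_cube, integral_fintype_prod_eq_prod (𝕜 := ℂ)
    (f := fun i (t : ℝ) => Complex.exp (2 * π * k i * t * Complex.I))]
  simp only [integral_exp_two_pi_int_mul]
  split_ifs with hk
  · simp [hk]
  · obtain ⟨i, hi⟩ := Function.ne_iff.1 hk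
    exact Finset.prod_eq_zero (Finset.mem_univ i) (if_neg hi)

/-- The trigonometric polynomial with frequencies in `Λ` and coefficients `a`. -/
def trigSum (d : ℕ) (Λ : Finset (Fin d → ℤ)) (a : (Fin d → ℤ) → ℂ) (x : Fin d → ℝ) : ℂ :=
  ∑ k ∈ Λ, a k * expk d k x

lemma continuous_trigSum (d : ℕ) (Λ : Finset (Fin d → ℤ)) (a : (Fin d → ℤ) → ℂ) :
    Continuous (trigSum d Λ a) :=
  continuous_finsetSum _ fun k _ => continuous_const.mul (continuous_expk d k)

lemma norm_trigSum_le (d : ℕ) (Λ : Finset (Fin d → ℤ)) (a : (Fin d → ℤ) → ℂ) (x : Fin d → ℝ) :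
    ‖trigSum d Λ a x‖ ≤ ∑ k ∈ Λ, ‖a k‖ :=
  (norm_sum_le _ _).trans_eq (by simp [norm_expk])

lemma integrable_trigSum (d : ℕ) (Λ : Finset (Fin d → ℤ)) (a : (Fin d → ℤ) → ℂ) :
    IntegrableOn (trigSum d Λ a) (cube d) := by
  have := isProbabilityMeasure_cube d
  exact Integrable.of_bound (continuous_trigSum d Λ a).aestronglyMeasurable _
    (.of_forall (norm_trigSum_le d Λ a))

lemma integrable_mul_expk (d : ℕ) {f : (Fin d → ℝ) → ℂ} (hf : IntegrableOn f (cube d))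
    (k : Fin d → ℤ) : IntegrableOn (fun x => f x * expk d k x) (cube d) :=
  Integrable.mul_bdd (c := 1) hf (continuous_expk d k).aestronglyMeasurable
    (.of_forall fun x => (norm_expk d k x).le)

lemma fCoeff_sub (d : ℕ) {f g : (Fin d → ℝ) → ℂ} (hf : IntegrableOn f (cube d))
    (hg : IntegrableOn g (cube d)) (k : Fin d → ℤ) :
    fCoeff d (f - g) k = fCoeff d f k - fCoeff d g k := by
  simp only [fCoeff, Pi.sub_apply, sub_mul]
  exact integral_sub (integrable_mul_expk d hf _) (integrable_mul_expk d hg _)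

lemma fCoeff_trigSum (d : ℕ) (Λ : Finset (Fin d → ℤ)) (a : (Fin d → ℤ) → ℂ) (l : Fin d → ℤ) :
    fCoeff d (trigSum d Λ a) l = if l ∈ Λ then a l else 0 := by
  have h : ∀ x, trigSum d Λ a x * expk d (-l) x = ∑ k ∈ Λ, a k * expk d (k + -l) x := by
    intro x
    simp only [trigSum, Finset.sum_mul, expk_add, mul_assoc]
  have hi : ∀ k : Fin d → ℤ, IntegrableOn (expk d k) (cube d) := fun k => by
    have : trigSum d {k} 1 = expk d k := by ext x; simp [trigSum]
    exact this ▸ integrable_trigSum d {k} 1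
  simp only [fCoeff, h]
  rw [integral_finsetSum _ fun k _ => (hi _).const_mul _]
  simp only [integral_const_mul, integral_expk, ← sub_eq_add_neg, sub_eq_zero, mul_ite, mul_one,
    mul_zero, Finset.sum_ite_eq']

/-- Parseval's identity for trigonometric polynomials. -/
lemma lintegral_trigSum_sq (d : ℕ) (Λ : Finset (Fin d → ℤ)) (a : (Fin d → ℤ) → ℂ) :
    ∫⁻ x in cube d, ‖trigSum d Λ a x‖ₑ ^ (2 : ℝ) = ∑ k ∈ Λ, ‖a k‖ₑ ^ (2 : ℝ) := by
  have := isProbabilityMeasure_cube d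
  have hE : ∀ z : ℂ, ‖z‖ₑ ^ (2 : ℝ) = ENNReal.ofReal (‖z‖ ^ 2) := fun z => by
    rw [← ofReal_norm, ENNReal.ofReal_rpow_of_nonneg (norm_nonneg _) zero_le_two, Real.rpow_two]
  have hc := continuous_trigSum d Λ a
  have hint : Integrable (fun x => ‖trigSum d Λ a x‖ ^ 2) (volume.restrict (cube d)) := by
    refine Integrable.of_bound (hc.norm.pow 2).aestronglyMeasurable ((∑ k ∈ Λ, ‖a k‖) ^ 2)
      (.of_forall fun x => ?_)
    rw [norm_pow, norm_norm]
    exact pow_le_pow_left₀ (norm_nonneg _) (norm_trigSum_le d Λ a x) 2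
  have key : ((∫ x in cube d, ‖trigSum d Λ a x‖ ^ 2 : ℝ) : ℂ) = ∑ k ∈ Λ, (‖a k‖ : ℂ) ^ 2 := by
    have h1 : ∀ x, ((‖trigSum d Λ a x‖ ^ 2 : ℝ) : ℂ) =
        ∑ k ∈ Λ, starRingEnd ℂ (a k) * (trigSum d Λ a x * expk d (-k) x) := fun x => by
      rw [Complex.ofReal_pow, ← Complex.mul_conj']
      conv_lhs => rw [trigSum.eq_def d Λ a x]
      rw [map_sum, ← trigSum, Finset.mul_sum]
      refine Finset.sum_congr rfl fun k _ => ?_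
      rw [map_mul, conj_expk]; ring
    rw [← integral_complex_ofReal]
    simp only [h1]
    rw [integral_finsetSum _ fun k _ =>
      (integrable_mul_expk d (integrable_trigSum d Λ a) _).const_mul _]
    refine Finset.sum_congr rfl fun k hk => ?_
    rw [integral_const_mul, ← fCoeff, fCoeff_trigSum, if_pos hk, Complex.conj_mul']
  have key' : ∫ x in cube d, ‖trigSum d Λ a x‖ ^ 2 = ∑ k ∈ Λ, ‖a k‖ ^ 2 := by
    exact_mod_cast key
  simp only [hE]
  rw [← ofReal_integral_eq_lintegral_ofReal hint (.of_forall fun x => by positivity), key',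
    ENNReal.ofReal_sum_of_nonneg fun k _ => by positivity]

/-- A Nikol'skii-type inequality for trigonometric polynomials with arbitrary frequencies: the
`L_2` norm is controlled by the `L_p` norm, `p ≤ 2`. -/
lemma sum_sq_rpow_le_lintegral (d : ℕ) (Λ : Finset (Fin d → ℤ)) (a : (Fin d → ℤ) → ℂ) {p : ℝ}
    (hp : 0 < p) (hp2 : p ≤ 2) :
    (∑ k ∈ Λ, ‖a k‖ₑ ^ (2 : ℝ)) ^ (p / 2) ≤
      (Λ.card : ℝ≥0∞) ^ (1 - p / 2) * ∫⁻ x in cube d, ‖trigSum d Λ a x‖ₑ ^ p := by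
  set S := ∑ k ∈ Λ, ‖a k‖ₑ ^ (2 : ℝ) with hS
  set I := ∫⁻ x in cube d, ‖trigSum d Λ a x‖ₑ ^ p with hI
  have hStop : S ≠ ∞ := ENNReal.sum_ne_top.2 fun k _ =>
    ENNReal.rpow_ne_top_of_nonneg zero_le_two enorm_ne_top
  rcases eq_or_ne S 0 with h0 | h0
  · rw [h0, ENNReal.zero_rpow_of_pos (by positivity)]
    exact zero_le
  have hsup : ∀ x, ‖trigSum d Λ a x‖ₑ ≤ (Λ.card * S) ^ (1 / 2 : ℝ) := fun x => by
    have h1 : ‖trigSum d Λ a x‖ₑ ≤ ∑ k ∈ Λ, ‖a k‖ₑ := by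
      refine (enorm_sum_le _ _).trans_eq (Finset.sum_congr rfl fun k _ => ?_)
      rw [enorm_mul, ← ofReal_norm (expk d k x), norm_expk, ENNReal.ofReal_one, mul_one]
    refine h1.trans ?_
    rw [one_div, ENNReal.le_rpow_inv_iff two_pos]
    refine (ENNReal.rpow_sum_le_const_mul_sum_rpow Λ _ one_le_two).trans_eq ?_
    rw [show (2 : ℝ) - 1 = 1 by norm_num, ENNReal.rpow_one]
  have hint : S ≤ (Λ.card * S) ^ (1 - p / 2) * I := by
    have hmeas : Measurable fun x => ‖trigSum d Λ a x‖ₑ ^ p :=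
      (continuous_trigSum d Λ a).measurable.enorm.pow_const _
    rw [hI, ← lintegral_const_mul _ hmeas]
    conv_lhs => rw [hS, ← lintegral_trigSum_sq]
    refine lintegral_mono fun x => ?_
    dsimp only
    rw [show (2 : ℝ) = (2 - p) + p by ring,
      ENNReal.rpow_add_of_nonneg _ _ (by linarith) hp.le]
    gcongr
    refine (ENNReal.rpow_le_rpow (hsup x) (by linarith)).trans_eq ?_
    rw [← ENNReal.rpow_mul]
    congr 1; ring
  have hc0 : S ^ (1 - p / 2) ≠ 0 := by simp [ENNReal.rpow_eq_zero_iff, h0, hStop]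
  have hct : S ^ (1 - p / 2) ≠ ∞ := ENNReal.rpow_ne_top_of_nonneg (by linarith) hStop
  rw [← ENNReal.mul_le_mul_iff_right hc0 hct, ← ENNReal.rpow_add _ _ h0 hStop,
    sub_add_cancel, ENNReal.rpow_one]
  rwa [ENNReal.mul_rpow_of_nonneg _ _ (by linarith), mul_comm (_ ^ _) (S ^ _), mul_assoc] at hint

lemma sum_rpow_le_lintegral (d : ℕ) (Λ : Finset (Fin d → ℤ)) (a : (Fin d → ℤ) → ℂ) {p θ : ℝ}
    (hp : 0 < p) (hp2 : p ≤ 2) (hθ : 0 < θ) (hθ2 : θ ≤ 2) :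
    ∑ k ∈ Λ, ‖a k‖ₑ ^ θ ≤ ((Λ.card : ℝ≥0∞) ^ (1 / p + 1 / θ - 1) *
      (∫⁻ x in cube d, ‖trigSum d Λ a x‖ₑ ^ p) ^ (1 / p)) ^ θ := by
  rcases Λ.eq_empty_or_nonempty with rfl | hΛ
  · simp
  have hN0 : (Λ.card : ℝ≥0∞) ≠ 0 := by simpa using hΛ.ne_empty
  have hNt : (Λ.card : ℝ≥0∞) ≠ ∞ := ENNReal.natCast_ne_top _
  have h1 := sum_sq_rpow_le_lintegral d Λ a hp hp2
  set S := ∑ k ∈ Λ, ‖a k‖ₑ ^ (2 : ℝ) with hS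
  set I := ∫⁻ x in cube d, ‖trigSum d Λ a x‖ₑ ^ p with hI
  set N := (Λ.card : ℝ≥0∞)
  have h2 : (∑ k ∈ Λ, ‖a k‖ₑ ^ θ) ^ (2 / θ) ≤ N ^ (2 / θ - 1) * S := by
    refine (ENNReal.rpow_sum_le_const_mul_sum_rpow Λ _
      ((one_le_div hθ).2 hθ2)).trans_eq ?_
    simp only [← ENNReal.rpow_mul, mul_div_cancel₀ _ hθ.ne']
    rfl
  have h3 : ∑ k ∈ Λ, ‖a k‖ₑ ^ θ ≤ (N ^ (2 / θ - 1) * S) ^ (θ / 2) := by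
    have := ENNReal.rpow_le_rpow h2 (z := θ / 2) (by positivity)
    rwa [← ENNReal.rpow_mul, div_mul_div_cancel₀ hθ.ne', div_self two_ne_zero,
      ENNReal.rpow_one] at this
  have h4 : S ≤ (N ^ (1 - p / 2) * I) ^ (2 / p) := by
    have := ENNReal.rpow_le_rpow h1 (z := 2 / p) (by positivity)
    rwa [← ENNReal.rpow_mul, div_mul_div_cancel₀ two_ne_zero, div_self hp.ne',
      ENNReal.rpow_one] at this
  refine h3.trans <| (ENNReal.rpow_le_rpow (mul_le_mul_right h4 _) (by positivity)).trans_eq ?_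
  have hθ' : (0 : ℝ) ≤ θ / 2 := by positivity
  have hp' : (0 : ℝ) ≤ 2 / p := by positivity
  rw [ENNReal.mul_rpow_of_nonneg _ _ hp', ENNReal.mul_rpow_of_nonneg _ _ hθ',
    ENNReal.mul_rpow_of_nonneg _ _ hθ', ENNReal.mul_rpow_of_nonneg _ _ hθ.le]
  simp only [← ENNReal.rpow_mul]
  rw [← mul_assoc, ← ENNReal.rpow_add _ _ hN0 hNt]
  congr 2
  · field_simp
    ring
  · field_simp

lemma card_blockF (n : ℕ) : (blockF n).card = 2 ^ n := by
  cases n with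
  | zero => rfl
  | succ n =>
    have h : blockF (n + 1) =
        Finset.Ico (2 ^ n) (2 ^ (n + 1)) ∪ Finset.Ioc (-2 ^ (n + 1)) (-2 ^ n) := by
      ext k
      have : (0 : ℤ) < 2 ^ n := by positivity
      simp only [blockF, Finset.mem_filter, Finset.mem_Icc, Finset.mem_union, Finset.mem_Ico,
        Finset.mem_Ioc, Nat.add_sub_cancel, le_abs, abs_lt, pow_succ]
      grind
    have : (0 : ℤ) < 2 ^ n := by positivity
    rw [h, Finset.card_union_of_disjoint, Int.card_Ico, Int.card_Ioc]
    · have h2 : ((2 ^ (n + 1) - 2 ^ n : ℤ)) = ((2 ^ n : ℕ) : ℤ) := by push_cast; ring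
      have h3 : ((-2 ^ n - -2 ^ (n + 1) : ℤ)) = ((2 ^ n : ℕ) : ℤ) := by push_cast; ring
      rw [h2, h3, Int.toNat_natCast, pow_succ]; ring
    · rw [Finset.disjoint_left]
      intro k
      simp only [Finset.mem_Ico, Finset.mem_Ioc]
      omega

lemma mem_blockF {n : ℕ} {k : ℤ} : k ∈ blockF n ↔ n = Nat.size k.natAbs := by
  have hk : |k| = (k.natAbs : ℤ) := Int.abs_eq_natAbs k
  rcases n with _ | n
  · rw [eq_comm, Nat.size_eq_zero]
    simp [blockF]
    grind
  · have h1 : n + 1 = Nat.size k.natAbs ↔ 2 ^ n ≤ k.natAbs ∧ k.natAbs < 2 ^ (n + 1) := by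
      rw [← Nat.size_le, ← Nat.lt_size]; omega
    rw [h1]
    simp only [blockF, Finset.mem_filter, Finset.mem_Icc, Nat.add_sub_cancel, hk]
    zify
    have := abs_lt (a := k) (b := 2 ^ (n + 1))
    have : (n : ℤ) + 1 ≠ 0 := by omega
    grind

/-- The frequency set `I_j` of the dyadic block projection. -/
def block (d : ℕ) (j : Fin d → ℕ) : Finset (Fin d → ℤ) :=
  Fintype.piFinset fun i => blockF (j i)

lemma mem_block {d : ℕ} {j : Fin d → ℕ} {k : Fin d → ℤ} :
    k ∈ block d j ↔ j = fun i => Nat.size (k i).natAbs := by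
  simp [block, mem_blockF, funext_iff]

lemma card_block (d : ℕ) (j : Fin d → ℕ) : (block d j).card = 2 ^ ∑ i, j i := by
  simp [block, card_blockF, Finset.prod_pow_eq_pow_sum]

lemma blockProj_eq_trigSum (d : ℕ) (f : (Fin d → ℝ) → ℂ) (j : Fin d → ℕ) :
    blockProj d f j = trigSum d (block d j) (fCoeff d f) := rfl

lemma tsum_eq_tsum_sum_block (d : ℕ) (g : (Fin d → ℤ) → ℝ≥0∞) :
    ∑' k, g k = ∑' j, ∑ k ∈ block d j, g k := by
  have h : ∀ j, ∑ k ∈ block d j, g k = ∑' k, if k ∈ block d j then g k else 0 := fun j => by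
    rw [tsum_eq_sum (s := block d j) fun k hk => if_neg hk]
    exact Finset.sum_congr rfl fun k hk => (if_pos hk).symm
  simp only [h]
  rw [ENNReal.tsum_comm]
  simp only [mem_block, tsum_ite_eq]

lemma LqNorm_eq (d : ℕ) {p : ℝ≥0∞} (hp : 0 < p) (hpt : p ≠ ∞) (f : (Fin d → ℝ) → ℂ) :
    LqNorm d p f = (∫⁻ x in cube d, ‖f x‖ₑ ^ p.toReal) ^ (1 / p.toReal) :=
  eLpNorm_eq_lintegral_rpow_enorm_toReal hp.ne' hpt

/-- The embedding `S^{1/p+1/θ-1}_{p,θ}B ⊂ A_θ`. -/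
lemma tsum_fCoeff_rpow_le_besovNorm (d : ℕ) {p θ : ℝ≥0∞} (hp : 0 < p) (hp2 : p ≤ 2)
    (hθ : 0 < θ) (hθ2 : θ ≤ 2) (f : (Fin d → ℝ) → ℂ) :
    ∑' k, ‖fCoeff d f k‖ₑ ^ θ.toReal ≤
      besovNorm d (1 / p.toReal + 1 / θ.toReal - 1) p θ f ^ θ.toReal := by
  have hpt : p ≠ ∞ := ne_top_of_le_ne_top ENNReal.ofNat_ne_top hp2
  have hθt : θ ≠ ∞ := ne_top_of_le_ne_top ENNReal.ofNat_ne_top hθ2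
  have hp0 : 0 < p.toReal := ENNReal.toReal_pos hp.ne' hpt
  have hθ0 : 0 < θ.toReal := ENNReal.toReal_pos hθ.ne' hθt
  have hp2' : p.toReal ≤ 2 := ENNReal.toReal_le_of_le_ofReal zero_le_two (by simpa using hp2)
  have hθ2' : θ.toReal ≤ 2 := ENNReal.toReal_le_of_le_ofReal zero_le_two (by simpa using hθ2)
  rw [besovNorm, if_neg hθt, ← ENNReal.rpow_mul, one_div_mul_cancel hθ0.ne', ENNReal.rpow_one,
    tsum_eq_tsum_sum_block]
  refine ENNReal.tsum_le_tsum fun j => ?_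
  refine (sum_rpow_le_lintegral d _ _ hp0 hp2' hθ0 hθ2').trans_eq ?_
  rw [LqNorm_eq d hp hpt, blockProj_eq_trigSum, card_block, Real.rpow_mul zero_le_two,
    Real.rpow_natCast, ← ENNReal.ofReal_rpow_of_pos (by positivity)]
  simp

lemma wienerNorm_zero_top (d : ℕ) (f : (Fin d → ℝ) → ℂ) :
    wienerNorm d 0 ∞ f = ⨆ k, ‖fCoeff d f k‖ₑ := by
  simp [wienerNorm, enorm_eq_nnnorm]

lemma wienerNorm_zero (d : ℕ) {η : ℝ≥0∞} (hη : η ≠ ∞) (f : (Fin d → ℝ) → ℂ) :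
    wienerNorm d 0 η f = (∑' k, ‖fCoeff d f k‖ₑ ^ η.toReal) ^ (1 / η.toReal) := by
  simp [wienerNorm, hη, enorm_eq_nnnorm]

/-- Stechkin's inequality: `σ_m(f)_{A_η} ≤ m^{-(1/θ-1/η)}` on the unit ball of `A_θ`. -/
lemma sigmaF_wienerNorm_le (d : ℕ) {m : ℕ} (hm : 1 ≤ m) {θ η : ℝ≥0∞} (hθ : 0 < θ)
    (hθη : θ < η) {f : (Fin d → ℝ) → ℂ} (hf : IntegrableOn f (cube d))
    (h : ∑' k, ‖fCoeff d f k‖ₑ ^ θ.toReal ≤ 1) :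
    sigmaF d m (wienerNorm d 0 η) f ≤
      ENNReal.ofReal ((m : ℝ) ^ (-(1 / θ.toReal - 1 / η.toReal))) := by
  have hθt : θ ≠ ∞ := hθη.ne_top
  have hθ0 : 0 < θ.toReal := ENNReal.toReal_pos hθ.ne' hθt
  have hmt : (m : ℝ≥0∞) ≠ ∞ := ENNReal.natCast_ne_top m
  have hmR : (0 : ℝ) < m := by exact_mod_cast hm
  obtain ⟨hfin, hcard⟩ := ENNReal.finset_card_const_le_le_of_tsum_le ENNReal.one_ne_top h
    (ENNReal.inv_ne_zero.2 hmt)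
  set Λ := hfin.toFinset with hΛ
  have hΛm : Λ.card ≤ m := by
    have : (Λ.card : ℝ≥0∞) ≤ m := by simpa using hcard
    exact_mod_cast this
  have hsmall : ∀ k ∉ Λ, ‖fCoeff d f k‖ₑ ≤ (m : ℝ≥0∞) ^ (-(1 / θ.toReal)) := fun k hk => by
    have hk' : ‖fCoeff d f k‖ₑ ^ θ.toReal ≤ (m : ℝ≥0∞)⁻¹ :=
      le_of_not_ge fun hle => hk (hfin.mem_toFinset.2 hle)
    rw [ENNReal.rpow_neg, ← ENNReal.inv_rpow, one_div, ENNReal.le_rpow_inv_iff hθ0]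
    exact hk'
  have hcoef : ∀ k, fCoeff d (f - trigSum d Λ (fCoeff d f)) k =
      if k ∈ Λ then 0 else fCoeff d f k := fun k => by
    rw [fCoeff_sub d hf (integrable_trigSum d _ _), fCoeff_trigSum]
    split_ifs <;> simp
  rw [← ENNReal.ofReal_rpow_of_pos hmR, ENNReal.ofReal_natCast]
  refine (iInf₂_le (trigSum d Λ (fCoeff d f)) ⟨Λ, fCoeff d f, hΛm, rfl⟩).trans ?_
  rcases eq_or_ne η ∞ with rfl | hηt
  · rw [wienerNorm_zero_top]
    refine iSup_le fun k => ?_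
    rw [hcoef]
    split_ifs with hk
    · simp
    · simpa using hsmall k hk
  · have hθη' : θ.toReal < η.toReal := (ENNReal.toReal_lt_toReal hθt hηt).2 hθη
    have hη0 : 0 < η.toReal := hθ0.trans hθη'
    rw [wienerNorm_zero d hηt, one_div η.toReal, ENNReal.rpow_inv_le_iff hη0]
    calc ∑' k, ‖fCoeff d (f - trigSum d Λ (fCoeff d f)) k‖ₑ ^ η.toReal
        ≤ ∑' k, ((m : ℝ≥0∞) ^ (-(1 / θ.toReal))) ^ (η.toReal - θ.toReal) *
            ‖fCoeff d f k‖ₑ ^ θ.toReal := by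
          refine ENNReal.tsum_le_tsum fun k => ?_
          rw [hcoef]
          split_ifs with hk
          · simp [hη0]
          · conv_lhs => rw [← sub_add_cancel η.toReal θ.toReal,
              ENNReal.rpow_add_of_nonneg _ _ (by linarith) hθ0.le]
            exact mul_le_mul_left (ENNReal.rpow_le_rpow (hsmall k hk) (by linarith)) _
      _ ≤ ((m : ℝ≥0∞) ^ (-(1 / θ.toReal))) ^ (η.toReal - θ.toReal) := by
          rw [ENNReal.tsum_mul_left]
          exact mul_le_of_le_one_right' h
      _ = ((m : ℝ≥0∞) ^ (-(1 / θ.toReal - η.toReal⁻¹))) ^ η.toReal := by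
          rw [← ENNReal.rpow_mul, ← ENNReal.rpow_mul]
          congr 1
          field_simp

lemma mul_le_wienerNorm_zero (d : ℕ) {η : ℝ≥0∞} (hη : 0 < η) {f : (Fin d → ℝ) → ℂ}
    {m : ℕ} (hm : 1 ≤ m) {G : Finset (Fin d → ℤ)} (hG : m ≤ G.card) {δ : ℝ≥0∞}
    (hδ : ∀ k ∈ G, δ ≤ ‖fCoeff d f k‖ₑ) :
    (m : ℝ≥0∞) ^ (1 / η.toReal) * δ ≤ wienerNorm d 0 η f := by
  rcases eq_or_ne η ∞ with rfl | hηt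
  · obtain ⟨k, hk⟩ := Finset.card_pos.1 (hm.trans hG)
    rw [wienerNorm_zero_top]
    simpa using (hδ k hk).trans (le_iSup (fun k => ‖fCoeff d f k‖ₑ) k)
  · have hη0 : 0 < η.toReal := ENNReal.toReal_pos hη.ne' hηt
    rw [wienerNorm_zero d hηt, one_div, ENNReal.le_rpow_inv_iff hη0,
      ENNReal.mul_rpow_of_nonneg _ _ hη0.le, ENNReal.rpow_inv_rpow hη0.ne']
    calc (m : ℝ≥0∞) * δ ^ η.toReal ≤ G.card * δ ^ η.toReal := by gcongr
      _ = ∑ k ∈ G, δ ^ η.toReal := by simp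
      _ ≤ ∑ k ∈ G, ‖fCoeff d f k‖ₑ ^ η.toReal :=
          Finset.sum_le_sum fun k hk => ENNReal.rpow_le_rpow (hδ k hk) hη0.le
      _ ≤ _ := ENNReal.sum_le_tsum G

lemma mul_le_sigmaF_wienerNorm (d : ℕ) {η : ℝ≥0∞} (hη : 0 < η) {f : (Fin d → ℝ) → ℂ}
    (hf : IntegrableOn f (cube d)) {m : ℕ} (hm : 1 ≤ m) {G : Finset (Fin d → ℤ)}
    (hG : 2 * m ≤ G.card) {δ : ℝ≥0∞} (hδ : ∀ k ∈ G, δ ≤ ‖fCoeff d f k‖ₑ) :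
    (m : ℝ≥0∞) ^ (1 / η.toReal) * δ ≤ sigmaF d m (wienerNorm d 0 η) f := by
  refine le_iInf₂ ?_
  rintro _ ⟨Λ, a, hΛ, rfl⟩
  refine mul_le_wienerNorm_zero d hη hm (G := G \ Λ) ?_ fun k hk => ?_
  · have := Finset.le_card_sdiff Λ G
    omega
  · rw [Finset.mem_sdiff] at hk
    have := fCoeff_sub d hf (integrable_trigSum d Λ a) k
    rw [fCoeff_trigSum, if_neg hk.2, sub_zero] at this
    exact (hδ k hk.1).trans_eq (congrArg _ this.symm)

lemma besovNorm_trigSum_block (d : ℕ) (s : ℝ) {p θ : ℝ≥0∞} (hθ : 0 < θ) (hθt : θ ≠ ∞)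
    (j : Fin d → ℕ) (a : (Fin d → ℤ) → ℂ) :
    besovNorm d s p θ (trigSum d (block d j) a) =
      ENNReal.ofReal ((2 : ℝ) ^ (((∑ i, j i : ℕ) : ℝ) * s)) *
        LqNorm d p (trigSum d (block d j) a) := by
  have hθ0 : 0 < θ.toReal := ENNReal.toReal_pos hθ.ne' hθt
  have hself : blockProj d (trigSum d (block d j) a) j = trigSum d (block d j) a := by
    ext x
    rw [blockProj_eq_trigSum]
    exact Finset.sum_congr rfl fun k hk => by rw [fCoeff_trigSum, if_pos hk]
  have hother : ∀ j' ≠ j, blockProj d (trigSum d (block d j) a) j' = 0 := fun j' hj' => by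
    ext x
    rw [blockProj_eq_trigSum]
    refine Finset.sum_eq_zero fun k hk => ?_
    rw [fCoeff_trigSum, if_neg, zero_mul]
    exact fun hk' => hj' ((mem_block.1 hk).trans (mem_block.1 hk').symm)
  rw [besovNorm, if_neg hθt, tsum_eq_single j, hself, ← ENNReal.rpow_mul,
    mul_one_div_cancel hθ0.ne', ENNReal.rpow_one]
  intro j' hj'
  rw [hother j' hj', LqNorm, eLpNorm_zero, mul_zero, ENNReal.zero_rpow_of_pos hθ0]

/-- The frequency `n` on the `i`-th coordinate axis. -/
def axisFreq {d : ℕ} (i : Fin d) (n : ℕ) : Fin d → ℤ := Pi.single i (n : ℤ)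

lemma axisFreq_injective {d : ℕ} (i : Fin d) : Function.Injective (axisFreq i) :=
  fun _ _ h => Nat.cast_injective (Pi.single_injective i h)

lemma axisFreq_add {d : ℕ} (i : Fin d) (m n : ℕ) :
    axisFreq i (m + n) = axisFreq i m + axisFreq i n := by
  rw [axisFreq, Nat.cast_add, Pi.single_add]; rfl

lemma axisFreq_mem_block {d : ℕ} (i : Fin d) {n ν : ℕ} (h : 2 ^ ν ≤ n) (h' : n < 2 ^ (ν + 1)) :
    axisFreq i n ∈ block d (Pi.single i (ν + 1)) := by
  have hs : Nat.size n = ν + 1 := by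
    have := Nat.size_le.2 h'
    have := Nat.lt_size.2 h
    omega
  rw [mem_block]
  ext l
  rcases eq_or_ne l i with rfl | hl
  · simp [axisFreq, hs]
  · simp [axisFreq, hl]

/-- The Dirichlet-type kernel `∑_{n < L} e^{2π i n x_i}`. -/
def axisKernel {d : ℕ} (i : Fin d) (L : ℕ) : (Fin d → ℝ) → ℂ :=
  trigSum d ((Finset.range L).image (axisFreq i)) 1

lemma axisKernel_apply {d : ℕ} (i : Fin d) (L : ℕ) (x : Fin d → ℝ) :
    axisKernel i L x = ∑ n ∈ Finset.range L, expk d (axisFreq i n) x := by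
  rw [axisKernel, trigSum, Finset.sum_image (axisFreq_injective i).injOn]
  simp

/-- The coefficients of the squared kernel `axisKernel i L ^ 2` shifted by `c`. -/
def sqCoeff {d : ℕ} (i : Fin d) (L c : ℕ) (k : Fin d → ℤ) : ℕ :=
  ((Finset.range L ×ˢ Finset.range L).filter fun q => axisFreq i (c + q.1 + q.2) = k).card

lemma le_sqCoeff {d : ℕ} (i : Fin d) {L c s l : ℕ} (hs : s < L) (hl : l ≤ s) :
    l ≤ sqCoeff i L c (axisFreq i (c + s)) := by
  have hinj : Function.Injective fun u : ℕ => (u, s - u) := fun u v h => (Prod.ext_iff.1 h).1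
  rw [← Finset.card_range l, ← Finset.card_image_of_injective _ hinj, sqCoeff]
  refine Finset.card_le_card fun q hq => ?_
  obtain ⟨u, hu, rfl⟩ := Finset.mem_image.1 hq
  rw [Finset.mem_range] at hu
  simp only [Finset.mem_filter, Finset.mem_product, Finset.mem_range]
  refine ⟨by omega, congrArg _ ?_⟩
  omega

lemma trigSum_sqCoeff {d : ℕ} (i : Fin d) {L ν : ℕ} (h : 2 * L ≤ 2 ^ ν) (t : ℂ)
    (x : Fin d → ℝ) :
    trigSum d (block d (Pi.single i (ν + 1))) (fun k => t * sqCoeff i L (2 ^ ν) k) x =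
      t * expk d (axisFreq i (2 ^ ν)) x * axisKernel i L x ^ 2 := by
  have hmem : ∀ q ∈ Finset.range L ×ˢ Finset.range L,
      axisFreq i (2 ^ ν + q.1 + q.2) ∈ block d (Pi.single i (ν + 1)) := fun q hq => by
    rw [Finset.mem_product, Finset.mem_range, Finset.mem_range] at hq
    exact axisFreq_mem_block i (by omega) (by rw [pow_succ]; omega)
  have hcoef : ∀ k, (sqCoeff i L (2 ^ ν) k : ℂ) = ∑ q ∈ Finset.range L ×ˢ Finset.range L,
      if axisFreq i (2 ^ ν + q.1 + q.2) = k then 1 else 0 := fun k => by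
    rw [sqCoeff, Finset.card_filter]; push_cast; rfl
  simp only [trigSum, hcoef, Finset.mul_sum, Finset.sum_mul]
  rw [Finset.sum_comm, axisKernel_apply, pow_two, Finset.sum_mul_sum, Finset.mul_sum,
    Finset.sum_product]
  simp only [Finset.mul_sum]
  refine Finset.sum_congr rfl fun u hu => Finset.sum_congr rfl fun v hv => ?_
  simp only [mul_ite, mul_one, mul_zero, ite_mul, zero_mul]
  rw [Finset.sum_ite_eq, if_pos (hmem (u, v) (Finset.mk_mem_product hu hv)), axisFreq_add,
    axisFreq_add, expk_add, expk_add]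
  ring

lemma enorm_axisKernel_le {d : ℕ} (i : Fin d) (L : ℕ) (x : Fin d → ℝ) :
    ‖axisKernel i L x‖ₑ ≤ L := by
  have : ‖axisKernel i L x‖ ≤ L := by
    rw [axisKernel_apply]
    exact (norm_sum_le _ _).trans_eq (by simp [norm_expk])
  rw [← ofReal_norm, ← ENNReal.ofReal_natCast]
  exact ENNReal.ofReal_le_ofReal this

lemma lintegral_axisKernel_sq {d : ℕ} (i : Fin d) (L : ℕ) :
    ∫⁻ x in cube d, ‖axisKernel i L x‖ₑ ^ (2 : ℝ) = L := by
  rw [axisKernel, lintegral_trigSum_sq]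
  simp [Finset.card_image_of_injective _ (axisFreq_injective i)]

lemma LqNorm_trigSum_sqCoeff_le {d : ℕ} (i : Fin d) {L ν : ℕ} (h : 2 * L ≤ 2 ^ ν) (t : ℂ)
    {p : ℝ≥0∞} (hp : 1 ≤ p) (hpt : p ≠ ∞) :
    LqNorm d p (trigSum d (block d (Pi.single i (ν + 1)))
      (fun k => t * sqCoeff i L (2 ^ ν) k)) ≤ ‖t‖ₑ * (L : ℝ≥0∞) ^ (2 - 1 / p.toReal) := by
  have hp1 : 1 ≤ p.toReal := by
    simpa using (ENNReal.toReal_le_toReal ENNReal.one_ne_top hpt).2 hp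
  have hp0 : 0 < p.toReal := by linarith
  have hpt1 : 1 / p.toReal ≤ 1 := (div_le_one hp0).2 hp1
  have hmeas : Measurable fun x => ‖axisKernel i L x‖ₑ ^ (2 : ℝ) :=
    (continuous_trigSum d _ _).measurable.enorm.pow_const _
  rw [LqNorm_eq d (by positivity) hpt, one_div, ENNReal.rpow_inv_le_iff hp0]
  calc ∫⁻ x in cube d, ‖trigSum d (block d (Pi.single i (ν + 1)))
          (fun k => t * sqCoeff i L (2 ^ ν) k) x‖ₑ ^ p.toReal
      ≤ ∫⁻ x in cube d, (‖t‖ₑ ^ p.toReal * (L : ℝ≥0∞) ^ (2 * p.toReal - 2)) *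
          ‖axisKernel i L x‖ₑ ^ (2 : ℝ) := by
        refine lintegral_mono fun x => ?_
        dsimp only
        rw [trigSum_sqCoeff i h, enorm_mul, enorm_mul, ← ofReal_norm (expk d _ x), norm_expk,
          ENNReal.ofReal_one, mul_one, ENNReal.mul_rpow_of_nonneg _ _ hp0.le, enorm_pow,
          ← ENNReal.rpow_natCast, ← ENNReal.rpow_mul, mul_assoc]
        gcongr
        rw [Nat.cast_ofNat, show 2 * p.toReal = (2 * p.toReal - 2) + 2 by ring,
          ENNReal.rpow_add_of_nonneg _ _ (by linarith) zero_le_two, add_sub_cancel_right]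
        gcongr
        · linarith
        · exact enorm_axisKernel_le i L x
    _ = (‖t‖ₑ * (L : ℝ≥0∞) ^ (2 - p.toReal⁻¹)) ^ p.toReal := by
        have hL : (L : ℝ≥0∞) ^ (2 * p.toReal - 2) * L = (L : ℝ≥0∞) ^ (2 * p.toReal - 1) := by
          conv_lhs => rw [← ENNReal.rpow_one (L : ℝ≥0∞)]
          rw [← ENNReal.rpow_mul, ← ENNReal.rpow_add_of_nonneg _ _ (by linarith) zero_le_one]
          congr 1; ring
        rw [lintegral_const_mul _ hmeas, lintegral_axisKernel_sq,
          ENNReal.mul_rpow_of_nonneg _ _ hp0.le, ← ENNReal.rpow_mul, mul_assoc, hL, sub_mul,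
          inv_mul_cancel₀ hp0.ne']

/-- the limiting case `r = 1/p + 1/θ - 1`:
`σ_m(S^r_{p,θ}B)_{A_η} ≍ m^{-(1/θ - 1/η)}` for `θ < η ≤ ∞`. -/
theorem statement15 (d : ℕ) (hd : 1 ≤ d) (p θ η : ℝ≥0∞) (hp1 : 1 < p) (hp2 : p ≤ 2)
    (hθ : 0 < θ) (hθ2 : θ ≤ 2) (hθη : θ < η) :
    IsAsympEquiv
      (fun m => sigmaClass d m
        (besovNorm d (1/p.toReal + 1/θ.toReal - 1) p θ) (wienerNorm d 0 η))
      (fun m => (m : ℝ) ^ (-(1/θ.toReal - 1/η.toReal))) := by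
  have hp0 : 0 < p := zero_lt_one.trans hp1
  have hpt : p ≠ ∞ := ne_top_of_le_ne_top ENNReal.ofNat_ne_top hp2
  have hθt : θ ≠ ∞ := hθη.ne_top
  have hη : 0 < η := hθ.trans hθη
  set r := 1 / p.toReal + 1 / θ.toReal - 1 with hr
  have hr0 : 0 ≤ r := by
    have h1 : 0 < p.toReal := ENNReal.toReal_pos hp0.ne' hpt
    have h2 : 0 < θ.toReal := ENNReal.toReal_pos hθ.ne' hθt
    have h3 : p.toReal ≤ 2 := ENNReal.toReal_le_of_le_ofReal zero_le_two (by simpa using hp2)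
    have h4 : θ.toReal ≤ 2 := ENNReal.toReal_le_of_le_ofReal zero_le_two (by simpa using hθ2)
    have h5 := one_div_le_one_div_of_le h1 h3
    have h6 := one_div_le_one_div_of_le h2 h4
    linarith
  refine ⟨2 / (32 ^ r * 4 ^ (2 - 1 / p.toReal)), 1, by positivity, one_pos, 1, fun m hm => ⟨?_, ?_⟩⟩
  · have hmR : (0 : ℝ) < m := by exact_mod_cast hm
    set t : ℝ := ((32 * m) ^ r * (4 * m) ^ (2 - 1 / p.toReal))⁻¹ with ht
    have ht0 : 0 < t := by positivity
    have hte : ‖(t : ℂ)‖ₑ = ENNReal.ofReal t := by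
      rw [← ofReal_norm, Complex.norm_real, Real.norm_of_nonneg ht0.le]
    let i : Fin d := ⟨0, hd⟩
    obtain ⟨ν, hν, hν'⟩ : ∃ ν : ℕ, 2 * (4 * m) ≤ 2 ^ ν ∧ 2 ^ (ν + 1) ≤ 32 * m := by
      refine ⟨Nat.size (8 * m), ?_, ?_⟩
      · have := Nat.lt_size_self (8 * m)
        omega
      · have h1 : 0 < Nat.size (8 * m) := Nat.size_pos.2 (by omega)
        have h2 : 2 ^ (Nat.size (8 * m) - 1) ≤ 8 * m := Nat.lt_size.1 (by omega)
        have h3 : Nat.size (8 * m) + 1 = Nat.size (8 * m) - 1 + 2 := by omega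
        rw [h3, pow_add]
        omega
    set f := trigSum d (block d (Pi.single i (ν + 1)))
      (fun k => (t : ℂ) * sqCoeff i (4 * m) (2 ^ ν) k) with hf
    have hfi : IntegrableOn f (cube d) := integrable_trigSum d _ _
    have hball : f ∈ unitBall d (besovNorm d r p θ) := by
      refine ⟨hfi, ?_⟩
      rw [hf, besovNorm_trigSum_block d r hθ hθt]
      refine (mul_le_mul_right (LqNorm_trigSum_sqCoeff_le i hν t hp1.le hpt) _).trans ?_
      have h1 : ((4 * m : ℕ) : ℝ≥0∞) ^ (2 - 1 / p.toReal) =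
          ENNReal.ofReal ((4 * m : ℝ) ^ (2 - 1 / p.toReal)) := by
        rw [← ENNReal.ofReal_rpow_of_pos (by positivity)]
        congr 1
        rw [← ENNReal.ofReal_natCast]
        push_cast; rfl
      have h2 : (2 : ℝ) ^ (((∑ l, (Pi.single i (ν + 1) : Fin d → ℕ) l : ℕ) : ℝ) * r) ≤
          (32 * m) ^ r := by
        rw [Finset.sum_pi_single', if_pos (Finset.mem_univ i), Real.rpow_mul zero_le_two,
          Real.rpow_natCast]
        exact Real.rpow_le_rpow (by positivity) (by exact_mod_cast hν') hr0
      rw [h1, hte, ← ENNReal.ofReal_mul ht0.le, ← ENNReal.ofReal_mul (by positivity),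
        ENNReal.ofReal_le_one]
      calc _ ≤ (32 * m : ℝ) ^ r * (t * (4 * m : ℝ) ^ (2 - 1 / p.toReal)) := by gcongr
        _ = 1 := by rw [ht]; field_simp
    refine le_trans ?_ (le_iSup₂_of_le f hball le_rfl)
    have hcoef : ∀ k ∈ (Finset.Ico (2 * m) (4 * m)).image fun s => axisFreq i (2 ^ ν + s),
        ENNReal.ofReal (t * (2 * m)) ≤ ‖fCoeff d f k‖ₑ := by
      intro k hk
      obtain ⟨s, hs, rfl⟩ := Finset.mem_image.1 hk
      rw [Finset.mem_Ico] at hs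
      have hmem : axisFreq i (2 ^ ν + s) ∈ block d (Pi.single i (ν + 1)) :=
        axisFreq_mem_block i (by omega) (by rw [pow_succ]; omega)
      have hle : (2 * m : ℝ) ≤ sqCoeff i (4 * m) (2 ^ ν) (axisFreq i (2 ^ ν + s)) := by
        exact_mod_cast le_sqCoeff i hs.2 hs.1
      rw [hf, fCoeff_trigSum, if_pos hmem, ← ofReal_norm, norm_mul, Complex.norm_real,
        Complex.norm_natCast, Real.norm_of_nonneg ht0.le]
      gcongr
    have hcard : 2 * m ≤
        ((Finset.Ico (2 * m) (4 * m)).image fun s => axisFreq i (2 ^ ν + s)).card := by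
      have hinj : Function.Injective fun s => axisFreq i (2 ^ ν + s) :=
        (axisFreq_injective i).comp (add_right_injective (2 ^ ν))
      rw [Finset.card_image_of_injective _ hinj, Nat.card_Ico]
      omega
    refine le_trans (le_of_eq ?_) (mul_le_sigmaF_wienerNorm d hη hfi hm hcard hcoef)
    rw [← ENNReal.ofReal_natCast, ENNReal.ofReal_rpow_of_pos hmR,
      ← ENNReal.ofReal_mul (by positivity)]
    congr 1
    have hexp : (m : ℝ) ^ (-(1 / θ.toReal - 1 / η.toReal)) * (m ^ r * m ^ (2 - 1 / p.toReal)) =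
        m ^ (1 / η.toReal) * m := by
      rw [← Real.rpow_add hmR, ← Real.rpow_add hmR, ← Real.rpow_add_one hmR.ne', hr]
      congr 1; ring
    rw [ht, Real.mul_rpow (by norm_num) hmR.le, Real.mul_rpow (by norm_num) hmR.le]
    field_simp
    linear_combination hexp
  · rw [one_mul]
    refine iSup₂_le fun f hf => sigmaF_wienerNorm_le d hm hθ hθη hf.1 ?_
    refine (tsum_fCoeff_rpow_le_besovNorm d hp0 hp2 hθ hθ2 f).trans ?_
    exact ENNReal.rpow_le_one hf.2 ENNReal.toReal_nonneg

end Paper
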